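/- Let E(n) = 2^{n-1} + ∑_{k=0}^{n} k!·S(n,k), where S(n,k) denotes the Stirling number of the second kind. Then lim_{n→∞} E(n) · (2·(ln 2)^{n+1}) / n! = 1; that is, E(n) is asymptotically equal to (n!/2)·(log₂ e)^{n+1}. -/

import Mathlib

/-- Stirling numbers of the second kind. -/
def stirling2 : ℕ → ℕ → ℕ
  | 0, 0 => 1
  | 0, _ + 1 => 0
  | _ + 1, 0 => 0
  | n + 1, k + 1 => (k + 1) * stirling2 n (k + 1) + stirling2 n k

open Finset in
/-- The `n`-th derivative of `z ↦ 1 / (2 - exp z)`, as a combination of Stirling numbers. -/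
noncomputable def fubiniDeriv (n : ℕ) (z : ℂ) : ℂ :=
  ∑ k ∈ range (n + 1), (k.factorial * stirling2 n k : ℂ) *
    (Complex.exp z ^ k / (2 - Complex.exp z) ^ (k + 1))

theorem stirling2_eq_zero_of_lt : ∀ {n k : ℕ}, n < k → stirling2 n k = 0
  | 0, 0, h => absurd h (lt_irrefl 0)
  | 0, _ + 1, _ => by rw [stirling2]
  | _ + 1, 0, h => absurd h (Nat.not_lt_zero _)
  | n + 1, k + 1, h => by
    rw [stirling2, stirling2_eq_zero_of_lt (Nat.lt_of_succ_lt_succ h),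
      stirling2_eq_zero_of_lt (Nat.lt_of_succ_lt h), mul_zero]

theorem fubiniDeriv_succ (n : ℕ) (z : ℂ) :
    fubiniDeriv (n + 1) z = ∑ k ∈ Finset.range (n + 1), (k.factorial * stirling2 n k : ℂ) *
      (k * (Complex.exp z ^ k / (2 - Complex.exp z) ^ (k + 1)) +
        (k + 1) * (Complex.exp z ^ (k + 1) / (2 - Complex.exp z) ^ (k + 2))) := by
  set u : ℕ → ℂ := fun k => Complex.exp z ^ k / (2 - Complex.exp z) ^ (k + 1)
  have hshift : ∑ k ∈ Finset.range (n + 1), (k.factorial * stirling2 n k : ℂ) * (k * u k) =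
      ∑ k ∈ Finset.range (n + 1),
        ((k + 1).factorial * stirling2 n (k + 1) : ℂ) * ((k + 1) * u (k + 1)) := by
    have h1 := Finset.sum_range_succ
      (fun k : ℕ => (k.factorial * stirling2 n k : ℂ) * (k * u k)) (n + 1)
    rw [Finset.sum_range_succ', stirling2_eq_zero_of_lt (Nat.lt_succ_self n)] at h1
    simpa using h1.symm
  have hsplit : ∑ k ∈ Finset.range (n + 1), (k.factorial * stirling2 n k : ℂ) *
      (k * u k + (k + 1) * u (k + 1)) =
      ∑ k ∈ Finset.range (n + 1), (((k + 1).factorial * stirling2 n (k + 1) : ℂ) *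
        ((k + 1) * u (k + 1)) + (k.factorial * stirling2 n k : ℂ) * ((k + 1) * u (k + 1))) := by
    rw [Finset.sum_add_distrib, ← hshift, ← Finset.sum_add_distrib]
    exact Finset.sum_congr rfl fun k _ => mul_add _ _ _
  refine Eq.trans ?_ hsplit.symm
  rw [fubiniDeriv, Finset.sum_range_succ']
  simp only [stirling2, Nat.cast_zero, mul_zero, zero_mul, add_zero]
  refine Finset.sum_congr rfl fun k _ => ?_
  simp only [u, Nat.factorial_succ]
  push_cast
  ring

theorem hasDerivAt_fubiniDeriv (n : ℕ) {z : ℂ} (hz : Complex.exp z ≠ 2) :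
    HasDerivAt (fubiniDeriv n) (fubiniDeriv (n + 1) z) z := by
  have h2 : 2 - Complex.exp z ≠ 0 := sub_ne_zero.2 hz.symm
  rw [fubiniDeriv_succ]
  refine HasDerivAt.fun_sum fun k _ => HasDerivAt.const_mul _ ?_
  have hd := ((Complex.hasDerivAt_exp z).fun_pow k).fun_div
    (((Complex.hasDerivAt_exp z).const_sub 2).fun_pow (k + 1)) (pow_ne_zero _ h2)
  refine hd.congr_deriv ?_
  rcases k with _ | k
  · simp
  · simp only [Nat.add_sub_cancel]
    push_cast
    field_simp
    ring

theorem fubiniDeriv_zero_right (n : ℕ) :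
    fubiniDeriv n 0 =
      ((∑ k ∈ Finset.range (n + 1), k.factorial * stirling2 n k : ℕ) : ℂ) := by
  simp only [fubiniDeriv, Complex.exp_zero, one_pow]
  norm_num

theorem iteratedDeriv_sub_mul_fubiniDeriv (c : ℂ) (n : ℕ) {z : ℂ} (hz : Complex.exp z ≠ 2) :
    iteratedDeriv n (fun w => (c - w) * fubiniDeriv 0 w) z =
      (c - z) * fubiniDeriv n z - n * fubiniDeriv (n - 1) z := by
  induction n generalizing z with
  | zero => simp
  | succ n ih =>
    rw [iteratedDeriv_succ]
    have hev : ∀ᶠ w in nhds z, Complex.exp w ≠ 2 :=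
      Complex.continuous_exp.continuousAt.eventually_ne hz
    rw [Filter.EventuallyEq.deriv_eq (hev.mono fun w hw => ih hw)]
    have h1 := ((hasDerivAt_id z).const_sub c).fun_mul (hasDerivAt_fubiniDeriv n hz)
    rcases n with _ | n
    · simpa [sub_eq_add_neg, add_comm] using h1.deriv
    · have h2 := h1.fun_sub ((hasDerivAt_fubiniDeriv n hz).const_mul ((n + 1 : ℕ) : ℂ))
      simp only [Nat.add_sub_cancel, id] at h2 ⊢
      rw [h2.deriv]
      push_cast
      ring

theorem exp_log_two : Complex.exp (Real.log 2 : ℝ) = 2 := by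
  rw [← Complex.ofReal_exp, Real.exp_log two_pos, Complex.ofReal_ofNat]

theorem eq_log_two_of_exp_eq_two {z : ℂ} (hz : ‖z‖ < 1) (h : Complex.exp z = 2) :
    z = (Real.log 2 : ℝ) := by
  rw [← exp_log_two, Complex.exp_eq_exp_iff_exists_int] at h
  obtain ⟨m, hm⟩ := h
  have him : z.im = m * (2 * Real.pi) := by
    rw [hm, Complex.add_im, Complex.ofReal_im]; simp
  have hlt : |(m : ℝ)| * (2 * Real.pi) < 1 := by
    have h3 := (Complex.abs_im_le_norm z).trans_lt hz
    rwa [him, abs_mul, abs_of_pos Real.two_pi_pos] at h3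
  have hm0 : m = 0 := by
    by_contra h0
    have h4 : (1 : ℝ) ≤ |(m : ℝ)| := by exact_mod_cast Int.one_le_abs h0
    nlinarith [Real.pi_gt_three]
  simpa [hm0] using hm

theorem dslope_exp_log_two_ne_zero {z : ℂ} (hz : ‖z‖ < 1) :
    dslope Complex.exp (Real.log 2 : ℝ) z ≠ 0 := by
  by_cases h : z = (Real.log 2 : ℝ)
  · rw [h, dslope_same, Complex.deriv_exp]
    exact Complex.exp_ne_zero _
  · rw [dslope_of_ne _ h, slope_def_field, exp_log_two]
    exact div_ne_zero (sub_ne_zero.2 fun h2 => h (eq_log_two_of_exp_eq_two hz h2))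
      (sub_ne_zero.2 h)

theorem inv_dslope_exp_log_two {z : ℂ} (hz : Complex.exp z ≠ 2) :
    (dslope Complex.exp (Real.log 2 : ℝ) z)⁻¹ =
      ((Real.log 2 : ℝ) - z) * fubiniDeriv 0 z := by
  have h : z ≠ (Real.log 2 : ℝ) := fun h => hz (h ▸ exp_log_two)
  rw [dslope_of_ne _ h, slope_def_field, exp_log_two, inv_div, ← neg_div_neg_eq]
  simp only [fubiniDeriv, stirling2, zero_add, Finset.sum_range_one, neg_sub]
  simp [div_eq_mul_inv]

theorem hasSum_fubini :
    HasSum (fun n : ℕ => (Real.log 2 : ℂ) ^ n / n.factorial *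
      (Real.log 2 * fubiniDeriv n 0 - n * fubiniDeriv (n - 1) 0)) (1 / 2) := by
  have hdiff : DifferentiableOn ℂ (fun z => (dslope Complex.exp (Real.log 2 : ℝ) z)⁻¹)
      (Metric.ball 0 1) := by
    refine DifferentiableOn.fun_inv ?_ fun z hz =>
      dslope_exp_log_two_ne_zero (mem_ball_zero_iff.1 hz)
    exact ((Complex.differentiableOn_dslope Filter.univ_mem).2
      Complex.differentiable_exp.differentiableOn).mono (Set.subset_univ _)
  have hmem : ((Real.log 2 : ℝ) : ℂ) ∈ Metric.ball (0 : ℂ) 1 := by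
    rw [mem_ball_zero_iff, Complex.norm_real, Real.norm_of_nonneg (Real.log_nonneg one_le_two)]
    linarith [Real.log_two_lt_d9]
  have hsum := Complex.hasSum_taylorSeries_on_ball hdiff hmem
  have hval : (dslope Complex.exp (Real.log 2 : ℝ) (Real.log 2 : ℝ))⁻¹ = 1 / 2 := by
    rw [dslope_same, Complex.deriv_exp, exp_log_two, one_div]
  rw [hval] at hsum
  have hev : (fun z => (dslope Complex.exp (Real.log 2 : ℝ) z)⁻¹) =ᶠ[nhds 0]
      fun z => ((Real.log 2 : ℝ) - z) * fubiniDeriv 0 z :=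
    (Complex.continuous_exp.continuousAt.eventually_ne (by norm_num)).mono
      fun z hz => inv_dslope_exp_log_two hz
  refine (congrArg (fun f => HasSum f (1 / 2 : ℂ)) (funext fun n => ?_)).mpr hsum
  rw [hev.iteratedDeriv_eq, iteratedDeriv_sub_mul_fubiniDeriv _ _ (by norm_num)]
  simp only [sub_zero, smul_eq_mul]
  ring

theorem sum_range_fubini (c : ℂ) (a : ℕ → ℂ) (n : ℕ) :
    ∑ k ∈ Finset.range (n + 1), c ^ k / k.factorial * (c * a k - k * a (k - 1)) =
      c ^ (n + 1) / n.factorial * a n := by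
  induction n with
  | zero => simp
  | succ n ih =>
    rw [Finset.sum_range_succ, ih, Nat.factorial_succ]
    have := Nat.factorial_ne_zero n
    push_cast
    have h : (n + 1 : ℂ) ≠ 0 := Nat.cast_add_one_ne_zero n
    field_simp
    ring

theorem tendsto_fubini :
    Filter.Tendsto (fun n : ℕ => Real.log 2 ^ (n + 1) / n.factorial *
      ((∑ k ∈ Finset.range (n + 1), k.factorial * stirling2 n k : ℕ) : ℝ))
      Filter.atTop (nhds (1 / 2)) := by
  have h := (Filter.tendsto_add_atTop_iff_nat 1).2 hasSum_fubini.tendsto_sum_nat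
  simp only [sum_range_fubini (Real.log 2 : ℂ) (fun n => fubiniDeriv n 0)] at h
  simp only [fubiniDeriv_zero_right] at h
  rw [← Filter.tendsto_ofReal_iff]
  convert h using 2 <;> simp

/-- The asymptotic formula (11) of the paper:
`E_IH(n) = 2^{n-1} + ∑_{k=0}^n k! S(n,k)` satisfies
`E_IH(n) ∼ (n!/2) (log₂ e)^{n+1}`, i.e.
`E_IH(n) · 2 (ln 2)^{n+1} / n! → 1`. -/
theorem stmt6 :
    Filter.Tendsto
      (fun n : ℕ =>
        ((2 ^ (n - 1) + ∑ k ∈ Finset.range (n + 1),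
            Nat.factorial k * stirling2 n k : ℕ) : ℝ) *
          (2 * Real.log 2 ^ (n + 1)) / Nat.factorial n)
      Filter.atTop (nhds 1) := by
  have hpow := (FloorSemiring.tendsto_pow_div_factorial_atTop (2 * Real.log 2)).const_mul
    (Real.log 2)
  have hlim := hpow.add (tendsto_fubini.const_mul 2)
  rw [mul_zero, zero_add, mul_one_div_cancel two_ne_zero] at hlim
  refine hlim.congr' ?_
  filter_upwards [Filter.eventually_ge_atTop 1] with n hn
  obtain ⟨m, rfl⟩ := Nat.exists_eq_add_of_le' hn
  rw [Nat.cast_add, Nat.cast_pow, Nat.add_sub_cancel]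
  push_cast
  ring
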